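/- Let i ≥ 1 be an integer and let x_0, x_1, …, x_{i+1} be pairwise distinct points of ℝ² such that x_j lies in column j for each j, and assume the kernel matrix Σ_{x_{0:i} x_{0:i}} is positive definite. If ξ < ρ/i and ξ⁴ < (ρ/i − ξ)(ρ − ξ²), then 0 ≤ ½·log( σ²_{x_{i+1}|x_i} / σ²_{x_{i+1}|x_{0:i}} ) ≤ Δ(i). (The middle quantity is the closed form of the conditional mutual information I[Z_{x_{i+1}}; Z_{x_{0:i−1}} | Z_{x_i}] for the Gaussian process with covariance σ.) -/

import Mathlib

open Real

/-- Squared exponential covariance function on ℝ². -/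
noncomputable def seCov (σs σn ℓ₁ ℓ₂ : ℝ) (u v : ℝ × ℝ) : ℝ :=
  σs ^ 2 * Real.exp (-((u.1 - v.1) ^ 2) / (2 * ℓ₁ ^ 2) - (u.2 - v.2) ^ 2 / (2 * ℓ₂ ^ 2)) +
    σn ^ 2 * (if u = v then 1 else 0)

/-- Kernel (covariance) matrix of a finite tuple of locations. -/
noncomputable def kerMat (σs σn ℓ₁ ℓ₂ : ℝ) {ι : Type} [Fintype ι]
    (x : ι → ℝ × ℝ) : Matrix ι ι ℝ :=
  Matrix.of fun j k => seCov σs σn ℓ₁ ℓ₂ (x j) (x k)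

/-- Posterior (conditional) variance σ²_{u|x} = σ(u,u) − Σ_{uX} Σ_{XX}⁻¹ Σ_{Xu}. -/
noncomputable def postVar (σs σn ℓ₁ ℓ₂ : ℝ) (u : ℝ × ℝ) {ι : Type} [Fintype ι] [DecidableEq ι]
    (x : ι → ℝ × ℝ) : ℝ :=
  seCov σs σn ℓ₁ ℓ₂ u u -
    ∑ j, ∑ k, seCov σs σn ℓ₁ ℓ₂ u (x j) * (kerMat σs σn ℓ₁ ℓ₂ x)⁻¹ j k *
      seCov σs σn ℓ₁ ℓ₂ (x k) u

/-- The per-stage bound Δ(i) on the Gaussian conditional mutual information (Δ(0) = 0). -/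
noncomputable def Del (ξ ρ : ℝ) (i : ℕ) : ℝ :=
  if i = 0 then 0
  else (1 / 2) * Real.log (1 - ξ ^ 4 / ((ρ / (i : ℝ) - ξ) * (ρ - ξ ^ 2)))⁻¹

open Matrix

/-- A symmetric matrix with constant diagonal `m` and off-diagonal entries bounded by `η` has all
its eigenvalues at least `m - (n - 1) * η`, in quadratic-form version. -/
theorem le_dotProduct_mulVec_of_offDiag_le {ι : Type*} [Fintype ι] [DecidableEq ι]
    (M : Matrix ι ι ℝ) (m η : ℝ) (hdiag : ∀ j, M j j = m)
    (hoff : ∀ j k, j ≠ k → |M j k| ≤ η) (t : ι → ℝ) :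
    (m - (Fintype.card ι - 1) * η) * (t ⬝ᵥ t) ≤ t ⬝ᵥ M *ᵥ t := by
  have entry : ∀ j k, -(η / 2) * (t j ^ 2 + t k ^ 2) + (if j = k then (m + η) * t j ^ 2 else 0) ≤
      t j * (M j k * t k) := by
    intro j k
    split_ifs with h
    · subst h
      rw [hdiag]
      nlinarith
    · have h₁ := hoff j k h
      rw [abs_le] at h₁
      nlinarith [mul_nonneg (sub_nonneg.2 h₁.2) (sq_nonneg (t j - t k)),
        mul_nonneg (neg_le_iff_add_nonneg.1 h₁.1) (sq_nonneg (t j + t k))]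
  have hsum := Finset.sum_le_sum fun j (_ : j ∈ Finset.univ) =>
    Finset.sum_le_sum fun k (_ : k ∈ Finset.univ) => entry j k
  simp only [Finset.sum_add_distrib, Finset.sum_ite_eq, Finset.mem_univ, if_true,
    ← Finset.mul_sum, Finset.sum_const, Finset.card_univ, nsmul_eq_mul] at hsum
  simp only [dotProduct, mulVec, ← pow_two]
  refine le_trans (le_of_eq ?_) hsum
  ring

/-- The quadratic form of `M⁻¹` exceeds its one-coordinate part `c i₀ ^ 2 / m` by a nonnegative
amount, controlled by the size `β` of the residual of `c` after regressing on coordinate `i₀`. -/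
theorem dotProduct_inv_mulVec_sub_bounds {ι : Type*} [Fintype ι] [DecidableEq ι]
    (M : Matrix ι ι ℝ) (hM : M.PosDef) (c : ι → ℝ) (i₀ : ι) (m η β : ℝ) (hm : 0 < m)
    (hdiag : ∀ j, M j j = m) (hoff : ∀ j k, j ≠ k → |M j k| ≤ η)
    (hlam : 0 < m - (Fintype.card ι - 1) * η)
    (hres : ∀ j, j ≠ i₀ → |c j - c i₀ / m * M j i₀| ≤ β) :
    0 ≤ c ⬝ᵥ M⁻¹ *ᵥ c - c i₀ ^ 2 / m ∧
      c ⬝ᵥ M⁻¹ *ᵥ c - c i₀ ^ 2 / m ≤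
        (Fintype.card ι - 1) * β ^ 2 / (m - (Fintype.card ι - 1) * η) := by
  set lam := m - (Fintype.card ι - 1) * η
  set w := M⁻¹ *ᵥ c with hw
  have hdet : IsUnit M.det := hM.det_pos.ne'.isUnit
  have hMw : M *ᵥ w = c := by rw [hw, mulVec_mulVec, mul_nonsing_inv _ hdet, one_mulVec]
  have hsymm : Mᵀ = M := by simpa using hM.isHermitian.eq
  set t : ι → ℝ := w - (c i₀ / m) • Pi.single i₀ 1 with ht
  set r : ι → ℝ := fun j => c j - c i₀ / m * M j i₀ with hr
  have hMt : M *ᵥ t = r := by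
    ext j
    simp [ht, hr, mulVec_sub, mulVec_smul, hMw]
  have hr₀ : r i₀ = 0 := by
    simp only [hr, hdiag]
    field_simp
    ring
  have hcol₀ : w ⬝ᵥ M.col i₀ = c i₀ := by
    rw [← congrFun hMw i₀, mulVec, dotProduct_comm]
    congr 1
    ext k
    exact congrFun (congrFun hsymm i₀) k
  have hD : t ⬝ᵥ r = c ⬝ᵥ w - c i₀ ^ 2 / m := by
    have h₁ : t ⬝ᵥ r = w ⬝ᵥ r := by
      simp [ht, sub_dotProduct, smul_dotProduct, hr₀]
    have h₂ : r = c - (c i₀ / m) • M.col i₀ := by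
      ext j
      simp [hr]
    rw [h₁, h₂, dotProduct_sub, dotProduct_smul, hcol₀, dotProduct_comm, smul_eq_mul]
    ring
  have hlow : lam * (t ⬝ᵥ t) ≤ t ⬝ᵥ r := by
    rw [← hMt]
    exact le_dotProduct_mulVec_of_offDiag_le M m η hdiag hoff t
  have hrr : r ⬝ᵥ r ≤ (Fintype.card ι - 1) * β ^ 2 := by
    have hterm : ∀ j, r j * r j ≤ β ^ 2 - (if j = i₀ then β ^ 2 else 0) := by
      intro j
      split_ifs with h
      · simp [h, hr₀]
      · have h₁ := sq_le_sq' (abs_le.1 (hres j h)).1 (abs_le.1 (hres j h)).2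
        simp only [hr]
        nlinarith
    refine (Finset.sum_le_sum fun j _ => hterm j).trans (le_of_eq ?_)
    simp [Finset.sum_sub_distrib]
    ring
  have htt : 0 ≤ t ⬝ᵥ t := Finset.sum_nonneg fun j _ => mul_self_nonneg (t j)
  rw [← hD]
  refine ⟨(mul_nonneg hlam.le htt).trans hlow, ?_⟩
  rw [le_div_iff₀ hlam]
  have hsq : 0 ≤ lam ^ 2 * (t ⬝ᵥ t) - 2 * lam * (t ⬝ᵥ r) + r ⬝ᵥ r := by
    have h₁ : 0 ≤ (lam • t - r) ⬝ᵥ (lam • t - r) :=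
      Finset.sum_nonneg fun j _ => mul_self_nonneg _
    simp only [sub_dotProduct, dotProduct_sub, smul_dotProduct, dotProduct_smul, smul_eq_mul,
      dotProduct_comm r t] at h₁
    linarith
  nlinarith [mul_le_mul_of_nonneg_left hlow hlam.le]

section Kernel

variable (σs σn ℓ₁ ℓ₂ : ℝ)

theorem seCov_comm (u v : ℝ × ℝ) : seCov σs σn ℓ₁ ℓ₂ u v = seCov σs σn ℓ₁ ℓ₂ v u := by
  simp only [seCov, eq_comm (a := u) (b := v)]
  ring_nf

theorem seCov_self (u : ℝ × ℝ) : seCov σs σn ℓ₁ ℓ₂ u u = σs ^ 2 + σn ^ 2 := by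
  simp [seCov]

theorem seCov_nonneg (u v : ℝ × ℝ) : 0 ≤ seCov σs σn ℓ₁ ℓ₂ u v := by
  unfold seCov
  positivity

/-- Locations at horizontal distance at least `d` have covariance at most `σs² exp(-d²/2ℓ₁²)`. -/
theorem seCov_le_of_le_abs_sub {u v : ℝ × ℝ} (huv : u ≠ v) {d : ℝ} (hd : 0 ≤ d)
    (h : d ≤ |u.1 - v.1|) :
    seCov σs σn ℓ₁ ℓ₂ u v ≤ σs ^ 2 * Real.exp (-d ^ 2 / (2 * ℓ₁ ^ 2)) := by
  have hsq : d ^ 2 ≤ (u.1 - v.1) ^ 2 := by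
    rw [← sq_abs (u.1 - v.1)]
    exact pow_le_pow_left₀ hd h 2
  have h₂ : 0 ≤ (u.2 - v.2) ^ 2 / (2 * ℓ₂ ^ 2) := by positivity
  have h₁ : -((u.1 - v.1) ^ 2) / (2 * ℓ₁ ^ 2) ≤ -d ^ 2 / (2 * ℓ₁ ^ 2) := by gcongr
  simp only [seCov, if_neg huv, mul_zero, add_zero]
  gcongr
  linarith

theorem postVar_eq_sub_dotProduct (u : ℝ × ℝ) {ι : Type} [Fintype ι] [DecidableEq ι]
    (x : ι → ℝ × ℝ) :
    postVar σs σn ℓ₁ ℓ₂ u x = (σs ^ 2 + σn ^ 2) -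
      (fun j => seCov σs σn ℓ₁ ℓ₂ (x j) u) ⬝ᵥ
        (kerMat σs σn ℓ₁ ℓ₂ x)⁻¹ *ᵥ fun j => seCov σs σn ℓ₁ ℓ₂ (x j) u := by
  simp only [postVar, seCov_self, dotProduct, mulVec, Finset.mul_sum, mul_assoc,
    seCov_comm σs σn ℓ₁ ℓ₂ u]

theorem postVar_single (u v : ℝ × ℝ) :
    postVar σs σn ℓ₁ ℓ₂ u (fun _ : Fin 1 => v) =
      (σs ^ 2 + σn ^ 2) - seCov σs σn ℓ₁ ℓ₂ v u ^ 2 / (σs ^ 2 + σn ^ 2) := by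
  have hinv : (kerMat σs σn ℓ₁ ℓ₂ fun _ : Fin 1 => v)⁻¹ 0 0 = (σs ^ 2 + σn ^ 2)⁻¹ := by
    rw [Matrix.inv_def]
    simp [kerMat, seCov_self]
  rw [postVar_eq_sub_dotProduct]
  simp only [dotProduct, mulVec, Fin.sum_univ_one, hinv]
  ring

end Kernel

/-- If `V - D` is obtained from `V` by a relative decrease of at most `B < 1`, the half log-ratio
lies between `0` and `½ log (1 - B)⁻¹`. -/
theorem half_log_div_sub_bounds {V D B : ℝ} (hV : 0 < V) (hD : 0 ≤ D) (hDB : D ≤ B * V)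
    (hB : B < 1) :
    0 ≤ (1 / 2) * Real.log (V / (V - D)) ∧
      (1 / 2) * Real.log (V / (V - D)) ≤ (1 / 2) * Real.log (1 - B)⁻¹ := by
  have hB' : 0 < 1 - B := by linarith
  have hpos : 0 < V - D := by nlinarith
  have hone : 1 ≤ V / (V - D) := by
    rw [le_div_iff₀ hpos]
    linarith
  refine ⟨mul_nonneg (by norm_num) (Real.log_nonneg hone), ?_⟩
  gcongr
  rw [div_le_iff₀ hpos, ← div_eq_inv_mul, le_div_iff₀ hB']
  linarith

theorem stmt_1 (σs σn ℓ₁ ℓ₂ ω₁ ω₂ ξ ρ : ℝ)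
    (hσs : 0 < σs) (hσn : 0 < σn) (hℓ₁ : 0 < ℓ₁) (hℓ₂ : 0 < ℓ₂)
    (hω₁ : 0 < ω₁) (hω₂ : 0 < ω₂)
    (hξ : ξ = Real.exp (-ω₁ ^ 2 / (2 * ℓ₁ ^ 2)))
    (hρ : ρ = 1 + σn ^ 2 / σs ^ 2)
    (i : ℕ) (hi : 1 ≤ i) (x : ℕ → ℝ × ℝ)
    (hdist : ∀ j ≤ i + 1, ∀ k ≤ i + 1, j ≠ k → x j ≠ x k)
    (hcol : ∀ j ≤ i + 1, (x j).1 = (j : ℝ) * ω₁)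
    (hPD : (kerMat σs σn ℓ₁ ℓ₂ (fun j : Fin (i + 1) => x j)).PosDef)
    (hξρ : ξ < ρ / i) (hξ4 : ξ ^ 4 < (ρ / i - ξ) * (ρ - ξ ^ 2)) :
    0 ≤ (1 / 2) * Real.log (postVar σs σn ℓ₁ ℓ₂ (x (i + 1)) (fun _ : Fin 1 => x i) /
        postVar σs σn ℓ₁ ℓ₂ (x (i + 1)) (fun j : Fin (i + 1) => x j)) ∧
    (1 / 2) * Real.log (postVar σs σn ℓ₁ ℓ₂ (x (i + 1)) (fun _ : Fin 1 => x i) /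
        postVar σs σn ℓ₁ ℓ₂ (x (i + 1)) (fun j : Fin (i + 1) => x j)) ≤ Del ξ ρ i := by
  have hs : 0 < σs ^ 2 := by positivity
  have hi₀ : (0 : ℝ) < i := by exact_mod_cast hi
  have hρ₁ : 1 < ρ := by
    rw [hρ]
    have : 0 < σn ^ 2 / σs ^ 2 := by positivity
    linarith
  have hm : σs ^ 2 + σn ^ 2 = σs ^ 2 * ρ := by
    rw [hρ]
    field_simp
  have hξ₀ : 0 < ξ := hξ ▸ Real.exp_pos _
  have hξ₁ : ξ ≤ 1 := by
    rw [hξ, Real.exp_le_one_iff]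
    exact div_nonpos_of_nonpos_of_nonneg (by nlinarith) (by positivity)
  have hρξ : 0 < ρ - ξ ^ 2 := by nlinarith
  have hiξ : 0 < ρ - i * ξ := by
    rw [lt_div_iff₀ hi₀] at hξρ
    linarith
  have hcov : ∀ j ≤ i + 1, ∀ k ≤ i + 1, j ≠ k →
      seCov σs σn ℓ₁ ℓ₂ (x j) (x k) ≤ σs ^ 2 * ξ := by
    intro j hj k hk hjk
    rw [hξ]
    refine seCov_le_of_le_abs_sub _ _ _ _ (hdist j hj k hk hjk) hω₁.le ?_
    rw [hcol j hj, hcol k hk, ← sub_mul, abs_mul, abs_of_pos hω₁]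
    have h₁ : (1 : ℝ) ≤ |(j : ℝ) - k| := by
      have : (1 : ℤ) ≤ |(j : ℤ) - k| := Int.one_le_abs (by omega)
      exact_mod_cast this
    nlinarith
  have hcov₂ : ∀ j < i, seCov σs σn ℓ₁ ℓ₂ (x j) (x (i + 1)) ≤ σs ^ 2 * ξ ^ 4 := by
    intro j hj
    have hξ4' : ξ ^ 4 = Real.exp (-(2 * ω₁) ^ 2 / (2 * ℓ₁ ^ 2)) := by
      rw [hξ, ← Real.exp_nat_mul]
      congr 1
      push_cast
      ring
    rw [hξ4']
    refine seCov_le_of_le_abs_sub _ _ _ _ (hdist j (by omega) _ le_rfl (by omega))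
      (by positivity) ?_
    rw [hcol j (by omega), hcol _ le_rfl, ← sub_mul, abs_mul, abs_of_pos hω₁, abs_sub_comm]
    have h₁ : (2 : ℝ) ≤ ((i + 1 : ℕ) : ℝ) - j := by
      have : ((j + 2 : ℕ) : ℝ) ≤ (i + 1 : ℕ) := by exact_mod_cast (by omega : j + 2 ≤ i + 1)
      push_cast at this ⊢
      linarith
    exact mul_le_mul_of_nonneg_right (h₁.trans (le_abs_self _)) hω₁.le
  have hnn := seCov_nonneg σs σn ℓ₁ ℓ₂
  set g := seCov σs σn ℓ₁ ℓ₂ (x i) (x (i + 1)) with hg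
  have hg₀ : 0 ≤ g := hnn _ _
  have hg₁ : g ≤ σs ^ 2 * ξ := hcov i (by omega) _ le_rfl (by omega)
  have hm₀ : 0 < σs ^ 2 + σn ^ 2 := by positivity
  have hgm : g / (σs ^ 2 + σn ^ 2) ≤ ξ := by
    rw [div_le_iff₀ hm₀]
    nlinarith
  have hgm₀ : 0 ≤ g / (σs ^ 2 + σn ^ 2) := by positivity
  obtain ⟨hD₀, hD₁⟩ := dotProduct_inv_mulVec_sub_bounds
    (kerMat σs σn ℓ₁ ℓ₂ fun j : Fin (i + 1) => x j) hPD
    (fun j : Fin (i + 1) => seCov σs σn ℓ₁ ℓ₂ (x j) (x (i + 1))) (Fin.last i)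
    (σs ^ 2 + σn ^ 2) (σs ^ 2 * ξ) (σs ^ 2 * ξ ^ 2) hm₀
    (fun j => seCov_self _ _ _ _ _)
    (by
      intro j k hjk
      rw [kerMat, of_apply, abs_of_nonneg (hnn _ _)]
      exact hcov j (by omega) k (by omega) (Fin.val_ne_of_ne hjk))
    (by
      rw [hm, Fintype.card_fin]
      push_cast
      nlinarith [mul_pos hs hiξ])
    (by
      intro j hj
      have hji : (j : ℕ) < i := Fin.val_lt_last hj
      have h₁ := hcov₂ j hji
      have h₂ := hcov j (by omega) i (by omega) hji.ne
      have h₃ : g / (σs ^ 2 + σn ^ 2) * seCov σs σn ℓ₁ ℓ₂ (x j) (x i) ≤ ξ * (σs ^ 2 * ξ) :=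
        mul_le_mul hgm h₂ (hnn _ _) hξ₀.le
      have h₄ : ξ ^ 4 ≤ ξ ^ 2 := pow_le_pow_of_le_one hξ₀.le hξ₁ (by norm_num)
      simp only [kerMat, of_apply, Fin.val_last, ← hg]
      rw [abs_le]
      constructor
      · nlinarith [hnn (x j) (x (i + 1))]
      · nlinarith [mul_nonneg hgm₀ (hnn (x j) (x i))])
  have hvar := postVar_eq_sub_dotProduct σs σn ℓ₁ ℓ₂ (x (i + 1)) fun j : Fin (i + 1) => x j
  have hvar₁ := postVar_single σs σn ℓ₁ ℓ₂ (x (i + 1)) (x i)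
  set Q := (fun j : Fin (i + 1) => seCov σs σn ℓ₁ ℓ₂ (x j) (x (i + 1))) ⬝ᵥ
    (kerMat σs σn ℓ₁ ℓ₂ fun j : Fin (i + 1) => x j)⁻¹ *ᵥ
      fun j : Fin (i + 1) => seCov σs σn ℓ₁ ℓ₂ (x j) (x (i + 1))
  simp only [Fin.val_last, ← hg] at hD₀ hD₁ hvar₁
  set V := postVar σs σn ℓ₁ ℓ₂ (x (i + 1)) fun _ : Fin 1 => x i
  have hV : σs ^ 2 * (ρ - ξ ^ 2) ≤ V := by
    have h₁ : g ^ 2 / (σs ^ 2 + σn ^ 2) ≤ ξ * (σs ^ 2 * ξ) := by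
      rw [pow_two, mul_div_right_comm]
      exact mul_le_mul hgm hg₁ hg₀ hξ₀.le
    rw [hvar₁, hm] at *
    linarith
  have hsplit : postVar σs σn ℓ₁ ℓ₂ (x (i + 1)) (fun j : Fin (i + 1) => x j) =
      V - (Q - g ^ 2 / (σs ^ 2 + σn ^ 2)) := by
    rw [hvar, hvar₁]
    ring
  have hgap : 0 < ρ / i - ξ := sub_pos.2 hξρ
  rw [hsplit, Del, if_neg (by omega)]
  refine half_log_div_sub_bounds ((mul_pos hs hρξ).trans_le hV) hD₀ ?_
    ((div_lt_one (mul_pos hgap hρξ)).2 hξ4)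
  calc Q - g ^ 2 / (σs ^ 2 + σn ^ 2)
      ≤ ξ ^ 4 / ((ρ / i - ξ) * (ρ - ξ ^ 2)) * (σs ^ 2 * (ρ - ξ ^ 2)) := by
        refine hD₁.trans (le_of_eq ?_)
        have h₁ : ρ / i - ξ = (ρ - i * ξ) / i := by field_simp
        have h₂ : σs ^ 2 * ρ - (i : ℝ) * (σs ^ 2 * ξ) = σs ^ 2 * (ρ - i * ξ) := by ring
        rw [Fintype.card_fin, Nat.cast_succ, add_sub_cancel_right, hm, h₁, h₂]
        field_simp
    _ ≤ ξ ^ 4 / ((ρ / i - ξ) * (ρ - ξ ^ 2)) * V := by gcongr
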